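/- Let T be a flat TQL TBox and q(x⃗,s⃗) a conjunctive query. Then there exists a union of conjunctive queries q′(x⃗,s⃗) such that, for any consistent knowledge base (T,A), any a⃗ ⊆ ind(A) and any n⃗ ⊆ ℤ: (T,A) ⊨ q(a⃗,n⃗) if and only if A^ℤ ⊨ q′(a⃗,n⃗). -/

import Mathlib

namespace TQL

/-! ## Syntax of TQL -/

/-- Basic roles: ⊥, a role name `P`, or an inverse role `P⁻`. -/
inductive BRole
  | bot
  | name (p : ℕ)
  | inv (p : ℕ)
deriving DecidableEq

/-- The inverse `R⁻` of a basic role. -/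
def BRole.minus : BRole → BRole
  | .bot => .bot
  | .name p => .inv p
  | .inv p => .name p

/-- Basic concepts: ⊥, a concept name `A`, or `∃R`. -/
inductive BConcept
  | bot
  | name (a : ℕ)
  | ex (r : BRole)
deriving DecidableEq

/-- TQL concepts. -/
inductive Concept
  | basic (b : BConcept)
  | inter (c₁ c₂ : Concept)
  | diaP (c : Concept)
  | diaF (c : Concept)
deriving DecidableEq

/-- TQL roles. -/
inductive Role
  | basic (r : BRole)
  | inter (s₁ s₂ : Role)
  | diaP (s : Role)
  | diaF (s : Role)
deriving DecidableEq

/-- TBox inclusions: `C ⊑ B` (B basic concept) and `S ⊑ R` (R basic role). -/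
inductive Inclusion
  | ci (c : Concept) (b : BConcept)
  | ri (s : Role) (r : BRole)
deriving DecidableEq

/-- A TQL TBox: a finite set of inclusions. -/
abbrev TBox := Finset Inclusion

/-- ABox atoms `A(a,n)` and `P(a,b,n)`. -/
inductive ABoxAtom
  | conc (a : ℕ) (x : ℕ) (n : ℤ)
  | role (p : ℕ) (x y : ℕ) (n : ℤ)
deriving DecidableEq

/-- A TQL ABox: a finite set of atoms. -/
abbrev ABox := Finset ABoxAtom

def ABoxAtom.inds : ABoxAtom → Finset ℕ
  | .conc _ x _ => {x}
  | .role _ x y _ => {x, y}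

def ABoxAtom.tems : ABoxAtom → Finset ℤ
  | .conc _ _ n => {n}
  | .role _ _ _ n => {n}

/-- `ind(A)`: the individual constants occurring in the ABox. -/
def aboxInds (A : ABox) : Finset ℕ := A.biUnion ABoxAtom.inds

/-- `tem(A)`: the temporal constants occurring in the ABox. -/
def aboxTems (A : ABox) : Finset ℤ := A.biUnion ABoxAtom.tems

/-! ### Names occurring in concepts, roles, TBoxes -/

def BRole.rnames : BRole → Finset ℕ
  | .bot => ∅
  | .name p => {p}
  | .inv p => {p}

def BConcept.cnames : BConcept → Finset ℕ
  | .bot => ∅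
  | .name a => {a}
  | .ex _ => ∅

def BConcept.rnames : BConcept → Finset ℕ
  | .bot => ∅
  | .name _ => ∅
  | .ex r => r.rnames

def Concept.cnames : Concept → Finset ℕ
  | .basic b => b.cnames
  | .inter c₁ c₂ => c₁.cnames ∪ c₂.cnames
  | .diaP c => c.cnames
  | .diaF c => c.cnames

def Concept.rnames : Concept → Finset ℕ
  | .basic b => b.rnames
  | .inter c₁ c₂ => c₁.rnames ∪ c₂.rnames
  | .diaP c => c.rnames
  | .diaF c => c.rnames

def Role.rnames : Role → Finset ℕ
  | .basic r => r.rnames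
  | .inter s₁ s₂ => s₁.rnames ∪ s₂.rnames
  | .diaP s => s.rnames
  | .diaF s => s.rnames

def Inclusion.cnames : Inclusion → Finset ℕ
  | .ci c b => c.cnames ∪ b.cnames
  | .ri _ _ => ∅

def Inclusion.rnames : Inclusion → Finset ℕ
  | .ci c b => c.rnames ∪ b.rnames
  | .ri s r => s.rnames ∪ r.rnames

/-- Concept names occurring in a TBox. -/
def cnamesT (T : TBox) : Finset ℕ := T.biUnion Inclusion.cnames

/-- Role names occurring in a TBox. -/
def rnamesT (T : TBox) : Finset ℕ := T.biUnion Inclusion.rnames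

/-- `|T|`: the number of concept and role names in `T`. -/
def sizeT (T : TBox) : ℕ := (cnamesT T).card + (rnamesT T).card

/-- `role(T)`: the role names of `T` together with their inverses. -/
def roleT (T : TBox) : Finset BRole :=
  (rnamesT T).image BRole.name ∪ (rnamesT T).image BRole.inv

/-- `|role(T)|`. -/
def roleTCard (T : TBox) : ℕ := (roleT T).card

/-! ### Normal forms -/

/-- An inclusion is in normal form if it has one of the shapes
`B₁ ⊓ B₂ ⊑ B`, `◇_F B₁ ⊑ B₂`, `◇_P B₁ ⊑ B₂` (for concepts), and analogously for roles. -/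
def Inclusion.InNF : Inclusion → Prop
  | .ci c _ =>
      (∃ B₁ B₂, c = .inter (.basic B₁) (.basic B₂)) ∨
      (∃ B, c = .diaF (.basic B)) ∨ (∃ B, c = .diaP (.basic B))
  | .ri s _ =>
      (∃ R₁ R₂, s = .inter (.basic R₁) (.basic R₂)) ∨
      (∃ R, s = .diaF (.basic R)) ∨ (∃ R, s = .diaP (.basic R))

/-- A TBox is in normal form. -/
def InNF (T : TBox) : Prop := ∀ incl ∈ T, incl.InNF

/-- A TBox in normal form is flat if no inclusion has a concept `∃R` on its right-hand side. -/
def IsFlat (T : TBox) : Prop :=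
  InNF T ∧ ∀ (c : Concept) (R : BRole), Inclusion.ci c (.ex R) ∉ T

/-! ## Semantics -/

/-- A temporal interpretation over a domain `D`: for each `n : ℤ` a structure, with rigid
injective interpretation of individual constants. -/
structure Interp (D : Type) where
  constI : ℕ → D
  constInj : Function.Injective constI
  concI : ℕ → ℤ → Set D
  roleI : ℕ → ℤ → Set (D × D)

variable {D : Type}

def BRole.interp (I : Interp D) : BRole → ℤ → Set (D × D)
  | .bot, _ => ∅
  | .name p, n => I.roleI p n
  | .inv p, n => {xy | (xy.2, xy.1) ∈ I.roleI p n}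

def BConcept.interp (I : Interp D) : BConcept → ℤ → Set D
  | .bot, _ => ∅
  | .name a, n => I.concI a n
  | .ex r, n => {x | ∃ y, (x, y) ∈ BRole.interp I r n}

def Concept.interp (I : Interp D) : Concept → ℤ → Set D
  | .basic b, n => BConcept.interp I b n
  | .inter c₁ c₂, n => Concept.interp I c₁ n ∩ Concept.interp I c₂ n
  | .diaP c, n => {x | ∃ m, m < n ∧ x ∈ Concept.interp I c m}
  | .diaF c, n => {x | ∃ m, n < m ∧ x ∈ Concept.interp I c m}

def Role.interp (I : Interp D) : Role → ℤ → Set (D × D)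
  | .basic r, n => BRole.interp I r n
  | .inter s₁ s₂, n => Role.interp I s₁ n ∩ Role.interp I s₂ n
  | .diaP s, n => {xy | ∃ m, m < n ∧ xy ∈ Role.interp I s m}
  | .diaF s, n => {xy | ∃ m, n < m ∧ xy ∈ Role.interp I s m}

/-- Satisfaction of an inclusion (globally, at all time points). -/
def Inclusion.holds (I : Interp D) : Inclusion → Prop
  | .ci c b => ∀ n, Concept.interp I c n ⊆ BConcept.interp I b n
  | .ri s r => ∀ n, Role.interp I s n ⊆ BRole.interp I r n

def ABoxAtom.holds (I : Interp D) : ABoxAtom → Prop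
  | .conc a x n => I.constI x ∈ I.concI a n
  | .role p x y n => (I.constI x, I.constI y) ∈ I.roleI p n

/-- `I` satisfies all inclusions of `T`. -/
def SatisfiesTBox (I : Interp D) (T : TBox) : Prop := ∀ incl ∈ T, incl.holds I

/-- `I` is a model of the KB `(T, A)`. -/
def IsModel (I : Interp D) (T : TBox) (A : ABox) : Prop :=
  SatisfiesTBox I T ∧ ∀ α ∈ A, α.holds I

/-- The KB `(T, A)` is consistent: it has a model (over a nonempty domain). -/
def Consistent (T : TBox) (A : ABox) : Prop :=
  ∃ (D : Type) (_ : Nonempty D) (I : Interp D), IsModel I T A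

/-! ## Conjunctive queries -/

/-- Atoms of conjunctive queries; `Sum.inl` is a constant, `Sum.inr` a variable. -/
inductive QAtom (νI νT : Type)
  | conc (a : ℕ) (ξ : ℕ ⊕ νI) (τ : ℤ ⊕ νT)
  | role (p : ℕ) (ξ ζ : ℕ ⊕ νI) (τ : ℤ ⊕ νT)
  | eq (τ σ : ℤ ⊕ νT)
  | lt (τ σ : ℤ ⊕ νT)

/-- A conjunctive query `q(x⃗, s⃗)` with `nx` free individual variables, `ns` free
temporal variables, `ny` bound individual variables and `nt` bound temporal variables. -/
structure CQ (nx ns : ℕ) where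
  ny : ℕ
  nt : ℕ
  atoms : List (QAtom (Fin nx ⊕ Fin ny) (Fin ns ⊕ Fin nt))

/-- A union of conjunctive queries. -/
abbrev UCQ (nx ns : ℕ) := List (CQ nx ns)

def evalIT {ι νI : Type} (cI : ℕ → ι) (g : νI → ι) : ℕ ⊕ νI → ι
  | .inl c => cI c
  | .inr v => g v

def evalTT {νT : Type} (g : νT → ℤ) : ℤ ⊕ νT → ℤ
  | .inl n => n
  | .inr v => g v

/-- Satisfaction of a query atom in a temporal interpretation. -/
def QAtom.holdsI {νI νT} (I : Interp D) (gI : νI → D) (gT : νT → ℤ) : QAtom νI νT → Prop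
  | .conc a ξ τ => evalIT I.constI gI ξ ∈ I.concI a (evalTT gT τ)
  | .role p ξ ζ τ => (evalIT I.constI gI ξ, evalIT I.constI gI ζ) ∈ I.roleI p (evalTT gT τ)
  | .eq τ σ => evalTT gT τ = evalTT gT σ
  | .lt τ σ => evalTT gT τ < evalTT gT σ

/-- `I ⊨ q(a⃗, n⃗)`: bound individual variables range over the domain, bound temporal
variables over ℤ. -/
def CQ.holdsInterp {nx ns} (q : CQ nx ns) (I : Interp D)
    (av : Fin nx → ℕ) (nv : Fin ns → ℤ) : Prop :=
  ∃ (bv : Fin q.ny → D) (bt : Fin q.nt → ℤ),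
    ∀ α ∈ q.atoms, QAtom.holdsI I (Sum.elim (fun i => I.constI (av i)) bv) (Sum.elim nv bt) α

/-- `(T, A) ⊨ q(a⃗, n⃗)`: certain answers. -/
def CertainAnswer (T : TBox) (A : ABox) {nx ns} (q : CQ nx ns)
    (av : Fin nx → ℕ) (nv : Fin ns → ℤ) : Prop :=
  ∀ (D : Type), Nonempty D → ∀ I : Interp D, IsModel I T A → q.holdsInterp I av nv

/-! ### Evaluation over data instances -/

/-- A two-sorted data instance: individual and temporal domains and the relations given
by its atoms (including the explicit precedence relation `<`). -/
structure DataInst where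
  indDom : Set ℕ
  temDom : Set ℤ
  concAt : ℕ → ℕ → ℤ → Prop
  roleAt : ℕ → ℕ → ℕ → ℤ → Prop
  ltAt : ℤ → ℤ → Prop

def QAtom.holdsData {νI νT} (Dt : DataInst) (gI : νI → ℕ) (gT : νT → ℤ) :
    QAtom νI νT → Prop
  | .conc a ξ τ => Dt.concAt a (evalIT id gI ξ) (evalTT gT τ)
  | .role p ξ ζ τ => Dt.roleAt p (evalIT id gI ξ) (evalIT id gI ζ) (evalTT gT τ)
  | .eq τ σ => evalTT gT τ = evalTT gT σ
  | .lt τ σ => Dt.ltAt (evalTT gT τ) (evalTT gT σ)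

/-- Evaluation of a CQ over a data instance: quantified variables range over the
individual/temporal domains of the instance. -/
def CQ.holdsOn {nx ns} (q : CQ nx ns) (Dt : DataInst)
    (av : Fin nx → ℕ) (nv : Fin ns → ℤ) : Prop :=
  ∃ (bv : Fin q.ny → ℕ), (∀ i, bv i ∈ Dt.indDom) ∧
    ∃ (bt : Fin q.nt → ℤ), (∀ j, bt j ∈ Dt.temDom) ∧
      ∀ α ∈ q.atoms, QAtom.holdsData Dt (Sum.elim av bv) (Sum.elim nv bt) α

/-- Evaluation of a UCQ over a data instance. -/
def UCQ.holdsOn {nx ns} (Q : UCQ nx ns) (Dt : DataInst)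
    (av : Fin nx → ℕ) (nv : Fin ns → ℤ) : Prop :=
  ∃ q ∈ Q, CQ.holdsOn q Dt av nv

/-- The convex closure of `tem(A)` in ℤ. -/
def temHull (A : ABox) : Set ℤ :=
  {n | ∃ n₁ ∈ aboxTems A, ∃ n₂ ∈ aboxTems A, n₁ ≤ n ∧ n ≤ n₂}

/-- The data instance `[A]`: `A` together with the precedence relation on the convex
closure of its temporal constants. -/
def bracketData (A : ABox) : DataInst where
  indDom := ↑(aboxInds A)
  temDom := temHull A
  concAt := fun a x n => ABoxAtom.conc a x n ∈ A
  roleAt := fun p x y n => ABoxAtom.role p x y n ∈ A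
  ltAt := fun n₁ n₂ => n₁ < n₂ ∧ n₁ ∈ temHull A ∧ n₂ ∈ temHull A

/-- The data instance `A^ℤ`: `A` together with the full precedence relation on ℤ. -/
def intData (A : ABox) : DataInst where
  indDom := ↑(aboxInds A)
  temDom := Set.univ
  concAt := fun a x n => ABoxAtom.conc a x n ∈ A
  roleAt := fun p x y n => ABoxAtom.role p x y n ∈ A
  ltAt := fun n₁ n₂ => n₁ < n₂

/-! ### Temporal constants of queries -/

def tcOf {νT : Type} : ℤ ⊕ νT → Finset ℤ
  | .inl n => {n}
  | .inr _ => ∅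

def QAtom.temConsts {νI νT} : QAtom νI νT → Finset ℤ
  | .conc _ _ τ => tcOf τ
  | .role _ _ _ τ => tcOf τ
  | .eq τ σ => tcOf τ ∪ tcOf σ
  | .lt τ σ => tcOf τ ∪ tcOf σ

def CQ.temConsts {nx ns} (q : CQ nx ns) : Finset ℤ :=
  (q.atoms.map QAtom.temConsts).foldr (· ∪ ·) ∅

def UCQ.temConsts {nx ns} (Q : UCQ nx ns) : Finset ℤ :=
  (Q.map CQ.temConsts).foldr (· ∪ ·) ∅

/-! ## The closure operators and canonical models -/

/-- Atoms used in the closure construction: `B(u,n)` for a basic concept `B`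
(covering `A(u,n)`, `∃R(u,n)` and `⊥(u,n)`), `R(u,v,n)` for a basic role and `(n < m)`. -/
inductive CAtom (ι : Type)
  | conc (B : BConcept) (u : ι) (n : ℤ)
  | rl (R : BRole) (u v : ι) (n : ℤ)
  | lt (n m : ℤ)

def CAtom.mentionsTime {ι} : CAtom ι → ℤ → Prop
  | .conc _ _ n, k => n = k
  | .rl _ _ _ n, k => n = k
  | .lt n m, k => n = k ∨ m = k

/-- A time point occurs in a set of atoms. -/
def timeOccurs {ι} (S : Set (CAtom ι)) (n : ℤ) : Prop := ∃ α ∈ S, CAtom.mentionsTime α n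

def CAtom.indsOf {ι} : CAtom ι → Set ι
  | .conc _ u _ => {u}
  | .rl _ u v _ => {u, v}
  | .lt _ _ => ∅

/-- The individual names occurring in a set of atoms. -/
def domOf {ι} (S : Set (CAtom ι)) : Set ι := {u | ∃ α ∈ S, u ∈ CAtom.indsOf α}

/-- `⊥` occurs in the set of atoms. -/
def hasBot {ι} (S : Set (CAtom ι)) : Prop :=
  (∃ u n, CAtom.conc .bot u n ∈ S) ∨ (∃ u v n, CAtom.rl .bot u v n ∈ S)

/-- One-step derivability by the rules (ex), (c1)–(c3), (r1)–(r3). -/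
inductive Deriv {ι} (T : TBox) (S : Set (CAtom ι)) : CAtom ι → Prop
  | ex₁ {R u v n} : CAtom.rl R u v n ∈ S → Deriv T S (.conc (.ex R) u n)
  | ex₂ {R u v n} : CAtom.rl R u v n ∈ S → Deriv T S (.conc (.ex R.minus) v n)
  | c1 {B₁ B₂ B u n} :
      Inclusion.ci (.inter (.basic B₁) (.basic B₂)) B ∈ T →
      CAtom.conc B₁ u n ∈ S → CAtom.conc B₂ u n ∈ S → Deriv T S (.conc B u n)
  | c2 {B B' u m n} :
      Inclusion.ci (.diaP (.basic B)) B' ∈ T →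
      CAtom.conc B u m ∈ S → m < n → timeOccurs S n → Deriv T S (.conc B' u n)
  | c3 {B B' u m n} :
      Inclusion.ci (.diaF (.basic B)) B' ∈ T →
      CAtom.conc B u m ∈ S → n < m → timeOccurs S n → Deriv T S (.conc B' u n)
  | r1 {R₁ R₂ R u v n} :
      Inclusion.ri (.inter (.basic R₁) (.basic R₂)) R ∈ T →
      CAtom.rl R₁ u v n ∈ S → CAtom.rl R₂ u v n ∈ S → Deriv T S (.rl R u v n)
  | r2 {R R' u v m n} :
      Inclusion.ri (.diaP (.basic R)) R' ∈ T →
      CAtom.rl R u v m ∈ S → m < n → timeOccurs S n → Deriv T S (.rl R' u v n)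
  | r3 {R R' u v m n} :
      Inclusion.ri (.diaF (.basic R)) R' ∈ T →
      CAtom.rl R u v m ∈ S → n < m → timeOccurs S n → Deriv T S (.rl R' u v n)

/-- The operator `cl`: one simultaneous (non-recursive) application of the rules. -/
def cl {ι} (T : TBox) (S : Set (CAtom ι)) : Set (CAtom ι) := S ∪ {α | Deriv T S α}

/-- `cl^∞`. -/
def clInf {ι} (T : TBox) (S : Set (CAtom ι)) : Set (CAtom ι) := ⋃ i, (cl T)^[i] S

/-! ### Tree individuals and the rule (⇝) -/

/-- Individuals of canonical models: an ABox individual constant together with a path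
of (time-offset, role) pairs recording applications of the rule (⇝);
`(a, [])` is the ABox individual `a` itself. -/
abbrev TreeInd := ℕ × List (ℤ × BRole)

/-- The absolute time at which the individual was created (sum of offsets). -/
def absOf (u : TreeInd) : ℤ := (u.2.map Prod.fst).sum

/-- The depth of a tree individual. -/
def depthOf (u : TreeInd) : ℕ := u.2.length

/-- The canonical fresh individual created by applying (⇝) to `u` at time `n` for `R`. -/
def succInd (u : TreeInd) (n : ℤ) (R : BRole) : TreeInd := (u.1, u.2 ++ [(n - absOf u, R)])

/-- The operator `cl₁`: `cl` together with the rule (⇝). -/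
def cl1 (T : TBox) (S : Set (CAtom TreeInd)) : Set (CAtom TreeInd) :=
  cl T S ∪ {α | ∃ R u n, α = CAtom.rl R u (succInd u n R) n ∧
      CAtom.conc (.ex R) u n ∈ S ∧ ∀ v, CAtom.rl R u v n ∉ S}

/-- `cl₁^∞`. -/
def cl1Inf (T : TBox) (S : Set (CAtom TreeInd)) : Set (CAtom TreeInd) := ⋃ i, (cl1 T)^[i] S

/-- `u ⇝ⁿ_R v` in the construction starting from `S`. -/
def LeadsTo (T : TBox) (S : Set (CAtom TreeInd)) (u : TreeInd) (n : ℤ) (R : BRole)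
    (v : TreeInd) : Prop :=
  v = succInd u n R ∧
    ∃ i, CAtom.conc (.ex R) u n ∈ (cl1 T)^[i] S ∧ ∀ w, CAtom.rl R u w n ∉ (cl1 T)^[i] S

/-- All atoms `(n < m)` with `n < m` in ℤ. -/
def ltAtoms {ι : Type} : Set (CAtom ι) := {α | ∃ n m : ℤ, n < m ∧ α = CAtom.lt n m}

def ABoxAtom.toC : ABoxAtom → CAtom ℕ
  | .conc a x n => .conc (.name a) x n
  | .role p x y n => .rl (.name p) x y n

def ABoxAtom.toCT : ABoxAtom → CAtom TreeInd
  | .conc a x n => .conc (.name a) (x, []) n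
  | .role p x y n => .rl (.name p) (x, []) (y, []) n

/-- The atoms of `A^ℤ` (over ABox individuals). -/
def initAtoms (A : ABox) : Set (CAtom ℕ) := (ABoxAtom.toC '' ↑A) ∪ ltAtoms

/-- The atoms of `A^ℤ` (over tree individuals). -/
def initAtomsT (A : ABox) : Set (CAtom TreeInd) := (ABoxAtom.toCT '' ↑A) ∪ ltAtoms

/-- The canonical model of a KB with a flat TBox, as a set of atoms over `ind(A)`. -/
def CKflat (T : TBox) (A : ABox) : Set (CAtom ℕ) := clInf T (initAtoms A)

/-- The canonical model `C_K` of a KB, identified with the set of atoms `cl₁^∞(A^ℤ)`. -/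
def CK (T : TBox) (A : ABox) : Set (CAtom TreeInd) := cl1Inf T (initAtomsT A)

/-! ### Evaluating CQs in canonical models (as sets of atoms) -/

def QAtom.holdsC {ι νI νT} (S : Set (CAtom ι)) (cI : ℕ → ι) (gI : νI → ι) (gT : νT → ℤ) :
    QAtom νI νT → Prop
  | .conc a ξ τ => CAtom.conc (.name a) (evalIT cI gI ξ) (evalTT gT τ) ∈ S
  | .role p ξ ζ τ =>
      CAtom.rl (.name p) (evalIT cI gI ξ) (evalIT cI gI ζ) (evalTT gT τ) ∈ S
  | .eq τ σ => evalTT gT τ = evalTT gT σ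
  | .lt τ σ => evalTT gT τ < evalTT gT σ

/-- Satisfaction of a CQ in a canonical model given as a set of atoms, with quantified
individual variables ranging over `dom` and temporal variables over ℤ. -/
def CQ.holdsC {nx ns ι} (q : CQ nx ns) (S : Set (CAtom ι)) (dom : Set ι) (cI : ℕ → ι)
    (av : Fin nx → ℕ) (nv : Fin ns → ℤ) : Prop :=
  ∃ (bv : Fin q.ny → ι), (∀ i, bv i ∈ dom) ∧ ∃ (bt : Fin q.nt → ℤ),
    ∀ α ∈ q.atoms, QAtom.holdsC S cI (Sum.elim (fun i => cI (av i)) bv) (Sum.elim nv bt) α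

/-! ### `K_{T,R}` and concept normal form -/

/-- The TBox of `K_{T,R}`: `T ∪ {A_g ⊑ ∃R}` where `g` is (the index of) a fresh
concept name. -/
def KTRT (T : TBox) (g : ℕ) (R : BRole) : TBox :=
  insert (.ci (.basic (.name g)) (.ex R)) T

/-- The ABox of `K_{T,R}`: `{A_g(a, 0)}`. -/
def KTRA (g a : ℕ) : ABox := {ABoxAtom.conc g a 0}

/-- The canonical model of `K_{T,R}` (as a set of atoms). -/
def CKTR (T : TBox) (g a : ℕ) (R : BRole) : Set (CAtom TreeInd) :=
  CK (KTRT T g R) (KTRA g a)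

/-- `T` is in concept normal form (CoNF). -/
def IsCoNF (T : TBox) : Prop :=
  InNF T ∧ ∀ R ∈ roleT T, ∃ Af : ℤ → ℕ,
    Inclusion.ci (.basic (.ex R)) (.name (Af 0)) ∈ T ∧
    Inclusion.ci (.diaF (.basic (.ex R))) (.name (Af (-1))) ∈ T ∧
    (∀ m : ℕ, m ≤ roleTCard T →
      Inclusion.ci (.diaF (.basic (.name (Af (-(m : ℤ)))))) (.name (Af (-(m : ℤ) - 1))) ∈ T) ∧
    Inclusion.ci (.diaP (.basic (.ex R))) (.name (Af 1)) ∈ T ∧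
    (∀ m : ℕ, m ≤ roleTCard T →
      Inclusion.ci (.diaP (.basic (.name (Af (m : ℤ))))) (.name (Af ((m : ℤ) + 1))) ∈ T) ∧
    (∀ m : ℤ, |m| ≤ (roleTCard T : ℤ) → ∀ R' : BRole, ∀ g a : ℕ, g ∉ cnamesT T →
      CAtom.rl R' (a, ([] : List (ℤ × BRole))) (succInd (a, []) 0 R) m ∈ CKTR T g a R →
      Inclusion.ci (.basic (.name (Af m))) (.ex R') ∈ T)

/-! ### Restrictions of canonical models -/

/-- `C_K^d`: restriction to individuals of depth at most `d`. -/
def CKd (T : TBox) (A : ABox) (d : ℕ) : Set (CAtom TreeInd) :=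
  {α | α ∈ CK T A ∧ ∀ u ∈ CAtom.indsOf α, depthOf u ≤ d}

/-- `n` lies in `[min tem(A) − ℓ, max tem(A) + ℓ]`. -/
def inWindow (A : ABox) (ℓ : ℕ) (n : ℤ) : Prop :=
  ∃ n₁ ∈ aboxTems A, ∃ n₂ ∈ aboxTems A, n₁ - ℓ ≤ n ∧ n ≤ n₂ + ℓ

/-- `C_K^{d,ℓ}`: further restriction to time points in the window. -/
def CKdl (T : TBox) (A : ABox) (d ℓ : ℕ) : Set (CAtom TreeInd) :=
  {α | α ∈ CKd T A d ∧ ∀ n, CAtom.mentionsTime α n → inWindow A ℓ n}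


/-! ## Queries over arbitrary finite variable types -/

/-- Renaming the variables of a query atom. -/
def QAtom.map {V V' W W' : Type} (f : V → V') (g : W → W') : QAtom V W → QAtom V' W'
  | .conc a ξ τ => .conc a (Sum.map id f ξ) (Sum.map id g τ)
  | .role p ξ ζ τ => .role p (Sum.map id f ξ) (Sum.map id f ζ) (Sum.map id g τ)
  | .eq τ σ => .eq (Sum.map id g τ) (Sum.map id g σ)
  | .lt τ σ => .lt (Sum.map id g τ) (Sum.map id g σ)

theorem evalIT_map {ι V V' : Type} (c : ℕ → ι) (g : V' → ι) (f : V → V') (ξ : ℕ ⊕ V) :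
    evalIT c g (Sum.map id f ξ) = evalIT c (g ∘ f) ξ := by
  cases ξ <;> rfl

theorem evalTT_map {W W' : Type} (g : W' → ℤ) (f : W → W') (τ : ℤ ⊕ W) :
    evalTT g (Sum.map id f τ) = evalTT (g ∘ f) τ := by
  cases τ <;> rfl

theorem QAtom.holdsData_map {V V' W W' : Type} (f : V → V') (g : W → W') (α : QAtom V W)
    (Dt : DataInst) (gI : V' → ℕ) (gT : W' → ℤ) :
    (α.map f g).holdsData Dt gI gT ↔ α.holdsData Dt (gI ∘ f) (gT ∘ g) := by
  cases α <;> simp only [QAtom.map, QAtom.holdsData, evalIT_map, evalTT_map]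

/-- A conjunctive query with free variables in `V`, `W` and bound variables in finite types. -/
structure GenCQ (V W : Type) where
  Y : Type
  Z : Type
  finY : Finite Y
  finZ : Finite Z
  atoms : List (QAtom (V ⊕ Y) (W ⊕ Z))

/-- Evaluation of a generalized conjunctive query over `A^ℤ`. -/
def GenCQ.holds {V W : Type} (c : GenCQ V W) (A : ABox) (av : V → ℕ) (nv : W → ℤ) : Prop :=
  ∃ bv : c.Y → ℕ, (∀ i, bv i ∈ aboxInds A) ∧ ∃ bt : c.Z → ℤ,
    ∀ α ∈ c.atoms, α.holdsData (intData A) (Sum.elim av bv) (Sum.elim nv bt)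

/-- A property of ABoxes and assignments that is defined over `A^ℤ` by a finite union of
conjunctive queries. -/
def Rewritable {V W : Type} (Φ : ABox → (V → ℕ) → (W → ℤ) → Prop) : Prop :=
  ∃ L : List (GenCQ V W), ∀ A av nv, Φ A av nv ↔ ∃ c ∈ L, c.holds A av nv

namespace Rewritable

variable {V W : Type}

theorem congr {Φ Ψ : ABox → (V → ℕ) → (W → ℤ) → Prop} (h : Rewritable Φ)
    (e : ∀ A av nv, Ψ A av nv ↔ Φ A av nv) : Rewritable Ψ := by
  obtain ⟨L, hL⟩ := h
  exact ⟨L, fun A av nv => (e A av nv).trans (hL A av nv)⟩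

theorem atom (α : QAtom V W) :
    Rewritable fun A av nv => α.holdsData (intData A) av nv := by
  refine ⟨[⟨Empty, Empty, inferInstance, inferInstance, [α.map Sum.inl Sum.inl]⟩],
    fun A av nv => ?_⟩
  simp only [GenCQ.holds, List.mem_singleton, exists_eq_left, forall_eq,
    QAtom.holdsData_map, Sum.elim_comp_inl]
  exact ⟨fun h => ⟨Empty.elim, fun i => i.elim, Empty.elim, h⟩, fun ⟨_, _, _, h⟩ => h⟩

theorem false : Rewritable fun (_ : ABox) (_ : V → ℕ) (_ : W → ℤ) => False :=
  ⟨[], by simp⟩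

theorem true : Rewritable fun (_ : ABox) (_ : V → ℕ) (_ : W → ℤ) => True := by
  refine ⟨[⟨Empty, Empty, inferInstance, inferInstance, []⟩], fun A av nv => ?_⟩
  simp only [GenCQ.holds, List.mem_singleton, exists_eq_left, true_iff]
  exact ⟨Empty.elim, fun i => i.elim, Empty.elim, by simp⟩

theorem or {Φ Ψ : ABox → (V → ℕ) → (W → ℤ) → Prop} (h : Rewritable Φ) (h' : Rewritable Ψ) :
    Rewritable fun A av nv => Φ A av nv ∨ Ψ A av nv := by
  obtain ⟨L, hL⟩ := h
  obtain ⟨L', hL'⟩ := h'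
  refine ⟨L ++ L', fun A av nv => ?_⟩
  simp only [hL, hL', List.mem_append, or_and_right, exists_or]

theorem and {Φ Ψ : ABox → (V → ℕ) → (W → ℤ) → Prop} (h : Rewritable Φ) (h' : Rewritable Ψ) :
    Rewritable fun A av nv => Φ A av nv ∧ Ψ A av nv := by
  obtain ⟨L, hL⟩ := h
  obtain ⟨L', hL'⟩ := h'
  let conj : GenCQ V W × GenCQ V W → GenCQ V W := fun p =>
    ⟨p.1.Y ⊕ p.2.Y, p.1.Z ⊕ p.2.Z,
      (have := p.1.finY; have := p.2.finY; inferInstance),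
      (have := p.1.finZ; have := p.2.finZ; inferInstance),
      p.1.atoms.map (QAtom.map (Sum.map id Sum.inl) (Sum.map id Sum.inl)) ++
        p.2.atoms.map (QAtom.map (Sum.map id Sum.inr) (Sum.map id Sum.inr))⟩
  have key : ∀ p A av nv, (conj p).holds A av nv ↔ p.1.holds A av nv ∧ p.2.holds A av nv := by
    intro p A av nv
    simp only [GenCQ.holds, conj, List.mem_append, or_imp, forall_and, List.mem_map,
      forall_exists_index, and_imp, forall_apply_eq_imp_iff₂, QAtom.holdsData_map,
      Sum.elim_comp_map, Function.comp_id]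
    constructor
    · rintro ⟨bv, hbv, bt, h₁, h₂⟩
      exact ⟨⟨bv ∘ Sum.inl, fun i => hbv _, bt ∘ Sum.inl, h₁⟩,
        ⟨bv ∘ Sum.inr, fun i => hbv _, bt ∘ Sum.inr, h₂⟩⟩
    · rintro ⟨⟨bv, hbv, bt, h₁⟩, ⟨bv', hbv', bt', h₂⟩⟩
      refine ⟨Sum.elim bv bv', ?_, Sum.elim bt bt', ?_, ?_⟩
      · rintro (i | i)
        exacts [hbv i, hbv' i]
      · simpa only [Sum.elim_comp_inl] using h₁
      · simpa only [Sum.elim_comp_inr] using h₂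
  refine ⟨(L ×ˢ L').map conj, fun A av nv => ?_⟩
  simp only [hL, hL', List.mem_map, List.mem_product, Prod.exists]
  constructor
  · rintro ⟨⟨c, hc, h⟩, ⟨c', hc', h'⟩⟩
    exact ⟨_, ⟨c, c', ⟨hc, hc'⟩, rfl⟩, (key _ _ _ _).2 ⟨h, h'⟩⟩
  · rintro ⟨_, ⟨c, c', ⟨hc, hc'⟩, rfl⟩, h⟩
    exact ⟨⟨c, hc, ((key _ _ _ _).1 h).1⟩, ⟨c', hc', ((key _ _ _ _).1 h).2⟩⟩

theorem existsInd {Y : Type} [Finite Y] {Φ : ABox → (V ⊕ Y → ℕ) → (W → ℤ) → Prop}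
    (h : Rewritable Φ) :
    Rewritable fun A (av : V → ℕ) nv =>
      ∃ bv : Y → ℕ, (∀ i, bv i ∈ aboxInds A) ∧ Φ A (Sum.elim av bv) nv := by
  obtain ⟨L, hL⟩ := h
  let bind : GenCQ (V ⊕ Y) W → GenCQ V W := fun c =>
    ⟨Y ⊕ c.Y, c.Z, (have := c.finY; inferInstance), c.finZ,
      c.atoms.map (QAtom.map (Equiv.sumAssoc V Y c.Y) id)⟩
  have key : ∀ c A av nv, (bind c).holds A av nv ↔
      ∃ bv : Y → ℕ, (∀ i, bv i ∈ aboxInds A) ∧ c.holds A (Sum.elim av bv) nv := by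
    intro c A av nv
    have aux : ∀ (b : Y → ℕ) (b' : c.Y → ℕ),
        Sum.elim av (Sum.elim b b') ∘ Equiv.sumAssoc V Y c.Y = Sum.elim (Sum.elim av b) b' := by
      intro b b'
      funext x
      rcases x with (x | x) | x <;> rfl
    simp only [GenCQ.holds, bind, List.mem_map, forall_exists_index, and_imp,
      forall_apply_eq_imp_iff₂, QAtom.holdsData_map, Function.comp_id]
    constructor
    · rintro ⟨bv, hbv, bt, h⟩
      refine ⟨bv ∘ Sum.inl, fun i => hbv _, bv ∘ Sum.inr, fun i => hbv _, bt, ?_⟩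
      rwa [← aux, Sum.elim_comp_inl_inr]
    · rintro ⟨b, hb, b', hb', bt, h⟩
      refine ⟨Sum.elim b b', ?_, bt, by rwa [aux]⟩
      rintro (i | i)
      exacts [hb i, hb' i]
  refine ⟨L.map bind, fun A av nv => ?_⟩
  simp only [hL, List.mem_map, exists_exists_and_eq_and, key]
  tauto

theorem existsTime {Z : Type} [Finite Z] {Φ : ABox → (V → ℕ) → (W ⊕ Z → ℤ) → Prop}
    (h : Rewritable Φ) :
    Rewritable fun A av (nv : W → ℤ) => ∃ bt : Z → ℤ, Φ A av (Sum.elim nv bt) := by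
  obtain ⟨L, hL⟩ := h
  let bind : GenCQ V (W ⊕ Z) → GenCQ V W := fun c =>
    ⟨c.Y, Z ⊕ c.Z, c.finY, (have := c.finZ; inferInstance),
      c.atoms.map (QAtom.map id (Equiv.sumAssoc W Z c.Z))⟩
  have key : ∀ c A av nv, (bind c).holds A av nv ↔
      ∃ bt : Z → ℤ, c.holds A av (Sum.elim nv bt) := by
    intro c A av nv
    have aux : ∀ (b : Z → ℤ) (b' : c.Z → ℤ),
        Sum.elim nv (Sum.elim b b') ∘ Equiv.sumAssoc W Z c.Z = Sum.elim (Sum.elim nv b) b' := by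
      intro b b'
      funext x
      rcases x with (x | x) | x <;> rfl
    simp only [GenCQ.holds, bind, List.mem_map, forall_exists_index, and_imp,
      forall_apply_eq_imp_iff₂, QAtom.holdsData_map, Function.comp_id]
    constructor
    · rintro ⟨bv, hbv, bt, h⟩
      refine ⟨bt ∘ Sum.inl, bv, hbv, bt ∘ Sum.inr, ?_⟩
      rwa [← aux, Sum.elim_comp_inl_inr]
    · rintro ⟨b, bv, hbv, b', h⟩
      exact ⟨bv, hbv, Sum.elim b b', by rwa [aux]⟩
  refine ⟨L.map bind, fun A av nv => ?_⟩
  simp only [hL, List.mem_map, exists_exists_and_eq_and, key]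
  tauto

theorem forallMem {ι : Type} (l : List ι) {Φ : ι → ABox → (V → ℕ) → (W → ℤ) → Prop}
    (h : ∀ i ∈ l, Rewritable (Φ i)) :
    Rewritable fun A av nv => ∀ i ∈ l, Φ i A av nv := by
  induction l with
  | nil => exact true.congr (by simp)
  | cons a l ih =>
    rw [List.forall_mem_cons] at h
    exact (h.1.and (ih h.2)).congr (by simp)

theorem existsMem {ι : Type} (l : List ι) {Φ : ι → ABox → (V → ℕ) → (W → ℤ) → Prop}
    (h : ∀ i ∈ l, Rewritable (Φ i)) :
    Rewritable fun A av nv => ∃ i ∈ l, Φ i A av nv := by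
  induction l with
  | nil => exact false.congr (by simp)
  | cons a l ih =>
    rw [List.forall_mem_cons] at h
    exact (h.1.or (ih h.2)).congr (by simp)

theorem forallFinite {ι : Type} [Finite ι] {Φ : ι → ABox → (V → ℕ) → (W → ℤ) → Prop}
    (h : ∀ i, Rewritable (Φ i)) :
    Rewritable fun A av nv => ∀ i, Φ i A av nv := by
  have := Fintype.ofFinite ι
  exact (forallMem Finset.univ.toList fun i _ => h i).congr (by simp)

theorem imp {p : Prop} {Φ : ABox → (V → ℕ) → (W → ℤ) → Prop} (h : Rewritable Φ) :
    Rewritable fun A av nv => p → Φ A av nv := by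
  by_cases hp : p
  · exact h.congr (by simp [hp])
  · exact true.congr (by simp [hp])

theorem exists_ucq {nx ns : ℕ} {Φ : ABox → (Fin nx → ℕ) → (Fin ns → ℤ) → Prop}
    (h : Rewritable Φ) :
    ∃ Q : UCQ nx ns, ∀ A av nv, Φ A av nv ↔ Q.holdsOn (intData A) av nv := by
  obtain ⟨L, hL⟩ := h
  have key : ∀ c : GenCQ (Fin nx) (Fin ns), ∃ q : CQ nx ns, ∀ A av nv,
      c.holds A av nv ↔ q.holdsOn (intData A) av nv := by
    rintro ⟨Y, Z, finY, finZ, atoms⟩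
    obtain ⟨ny, ⟨e⟩⟩ := Finite.exists_equiv_fin Y
    obtain ⟨nt, ⟨e'⟩⟩ := Finite.exists_equiv_fin Z
    refine ⟨⟨ny, nt, atoms.map (QAtom.map (Sum.map id e) (Sum.map id e'))⟩, fun A av nv => ?_⟩
    simp only [GenCQ.holds, CQ.holdsOn, List.mem_map, forall_exists_index, and_imp,
      forall_apply_eq_imp_iff₂, QAtom.holdsData_map, Sum.elim_comp_map, Function.comp_id]
    constructor
    · rintro ⟨bv, hbv, bt, h⟩
      refine ⟨bv ∘ e.symm, fun i => hbv _, bt ∘ e'.symm, fun _ => trivial, ?_⟩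
      simpa [Function.comp_assoc] using h
    · rintro ⟨bv, hbv, bt, -, h⟩
      exact ⟨bv ∘ e, fun i => hbv _, bt ∘ e', h⟩
  choose f hf using key
  refine ⟨L.map f, fun A av nv => ?_⟩
  simp only [hL, UCQ.holdsOn, List.mem_map, exists_exists_and_eq_and, hf]

end Rewritable

/-! ## Temporal Horn closure on the integers -/

/-- The closure of the data `d` under the rules `b₁ ∧ b₂ → b` (`J`), `◇_P b₁ → b` (`P`) and
`◇_F b₁ → b` (`F`). -/
inductive HornClosure {β : Type} (J : β → β → β → Prop) (P F : β → β → Prop)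
    (d : ℤ → β → Prop) : β → ℤ → Prop
  | base {b n} : d n b → HornClosure J P F d b n
  | join {b₁ b₂ b n} : J b₁ b₂ b → HornClosure J P F d b₁ n → HornClosure J P F d b₂ n →
      HornClosure J P F d b n
  | past {b₁ b m n} : P b₁ b → HornClosure J P F d b₁ m → m < n → HornClosure J P F d b n
  | future {b₁ b m n} : F b₁ b → HornClosure J P F d b₁ m → n < m → HornClosure J P F d b n

theorem HornClosure.exists_base {β : Type} {J : β → β → β → Prop} {P F : β → β → Prop}
    {d : ℤ → β → Prop} {b : β} {n : ℤ} (h : HornClosure J P F d b n) : ∃ m c, d m c := by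
  induction h with
  | base h => exact ⟨_, _, h⟩
  | join _ _ _ ih _ => exact ih
  | past _ _ _ ih => exact ih
  | future _ _ _ ih => exact ih

/-- A word of labelled positions occurs in `d`, its marked positions being sent to `n`. -/
def Matches {β : Type} (l : List (Finset β × Bool)) (d : ℤ → β → Prop) (n : ℤ) : Prop :=
  ∃ f : Fin l.length → ℤ, (∀ i j, i < j → f i < f j) ∧
    ∀ i, (∀ b ∈ (l.get i).1, d (f i) b) ∧ ((l.get i).2 = true → f i = n)

theorem Matches.of_sublist {β : Type} {l l' : List (Finset β × Bool)} {d : ℤ → β → Prop} {n : ℤ}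
    (h : Matches l d n) (hl : l'.Sublist l) : Matches l' d n := by
  obtain ⟨f, hf, h⟩ := h
  obtain ⟨e, he⟩ := List.sublist_iff_exists_fin_orderEmbedding_get_eq.1 hl
  refine ⟨f ∘ e, fun i j hij => hf _ _ (e.strictMono hij), fun i => ?_⟩
  rw [he]
  exact h (e i)

/-- A derivation only inspects the data at finitely many time points, and only depends on
their order. -/
theorem HornClosure.exists_support {β : Type} {J : β → β → β → Prop} {P F : β → β → Prop}
    {s : Finset β} (hJ : ∀ b₁ b₂ b, J b₁ b₂ b → b₁ ∈ s ∧ b₂ ∈ s) (hP : ∀ b₁ b, P b₁ b → b₁ ∈ s)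
    (hF : ∀ b₁ b, F b₁ b → b₁ ∈ s) {d : ℤ → β → Prop} {b : β} {n : ℤ}
    (h : HornClosure J P F d b n) (hb : b ∈ s) :
    ∃ K : Finset ℤ, n ∈ K ∧ ∀ (d' : ℤ → β → Prop) (φ : ℤ → ℤ), StrictMonoOn φ K →
      (∀ t ∈ K, ∀ c ∈ s, d t c → d' (φ t) c) → HornClosure J P F d' b (φ n) := by
  induction h with
  | @base b n h =>
    exact ⟨{n}, by simp, fun d' φ _ hd => .base (hd n (by simp) b hb h)⟩
  | join hj _ _ ih₁ ih₂ =>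
    obtain ⟨K₁, hn, h₁⟩ := ih₁ (hJ _ _ _ hj).1
    obtain ⟨K₂, -, h₂⟩ := ih₂ (hJ _ _ _ hj).2
    refine ⟨K₁ ∪ K₂, Finset.mem_union_left _ hn, fun d' φ hφ hd => .join hj
      (h₁ d' φ (hφ.mono (by simp)) fun t ht => hd t (Finset.mem_union_left _ ht))
      (h₂ d' φ (hφ.mono (by simp)) fun t ht => hd t (Finset.mem_union_right _ ht))⟩
  | @past b₁ b m n hp _ hmn ih =>
    obtain ⟨K, hm, h⟩ := ih (hP _ _ hp)
    refine ⟨insert n K, Finset.mem_insert_self _ _, fun d' φ hφ hd => .past hp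
      (h d' φ (hφ.mono (by simp)) fun t ht => hd t (Finset.mem_insert_of_mem ht))
      (hφ (by simp [hm]) (by simp) hmn)⟩
  | @future b₁ b m n hp _ hmn ih =>
    obtain ⟨K, hm, h⟩ := ih (hF _ _ hp)
    refine ⟨insert n K, Finset.mem_insert_self _ _, fun d' φ hφ hd => .future hp
      (h d' φ (hφ.mono (by simp)) fun t ht => hd t (Finset.mem_insert_of_mem ht))
      (hφ (by simp) (by simp [hm]) hmn)⟩

/-- A set of words over a finite alphabet has finitely many minimal elements in the subword
order, and every word of the set lies above one of them. -/
theorem exists_finite_sublist_basis {α : Type} {s : Set α} (hs : s.Finite) {S : Set (List α)}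
    (hS : ∀ l ∈ S, ∀ x ∈ l, x ∈ s) :
    ∃ M : List (List α), (∀ l ∈ M, l ∈ S) ∧ ∀ l ∈ S, ∃ l' ∈ M, l'.Sublist l := by
  have pwo : S.PartiallyWellOrderedOn List.Sublist := by
    have := (Set.PartiallyWellOrderedOn.partiallyWellOrderedOn_sublistForall₂ (· = ·)
      (hs.partiallyWellOrderedOn (r := (· = ·)))).mono hS
    intro f
    obtain ⟨m, n, hmn, h⟩ := this f
    refine ⟨m, n, hmn, ?_⟩
    obtain ⟨l, hl, hl'⟩ := List.sublistForall₂_iff.1 h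
    rw [List.forall₂_eq_eq_eq] at hl
    change (f m : List α).Sublist (f n)
    rwa [hl]
  let M : Set (List α) := {l | l ∈ S ∧ ∀ l' ∈ S, l'.Sublist l → l' = l}
  have hM : M.Finite := by
    refine IsAntichain.finite_of_partiallyWellOrderedOn (r := List.Sublist) ?_
      (pwo.mono fun l hl => hl.1)
    intro l hl l' hl' hne h
    exact hne (hl'.2 l hl.1 h)
  refine ⟨hM.toFinset.toList, fun l hl => ?_, fun l hl => ?_⟩
  · simp only [Finset.mem_toList, Set.Finite.mem_toFinset] at hl
    exact hl.1
  · simp only [Finset.mem_toList, Set.Finite.mem_toFinset]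
    induction hk : l.length using Nat.strong_induction_on generalizing l with
    | _ k ih =>
      by_cases hmin : l ∈ M
      · exact ⟨l, hmin, List.Sublist.refl l⟩
      · have : ∃ l' ∈ S, l'.Sublist l ∧ l' ≠ l := by
          by_contra! hcon
          exact hmin ⟨hl, hcon⟩
        obtain ⟨l', hl', hsub, hne⟩ := this
        have hlt : l'.length < k :=
          hk ▸ lt_of_le_of_ne hsub.length_le fun h => hne (hsub.eq_of_length h)
        obtain ⟨l'', hl'', hsub'⟩ := ih _ hlt l' hl' rfl
        exact ⟨l'', hl'', hsub'.trans hsub⟩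

/-- Derivability in the Horn closure is detected by finitely many words. -/
theorem HornClosure.exists_matches_iff {β : Type} {J : β → β → β → Prop} {P F : β → β → Prop}
    {s : Finset β} (hJ : ∀ b₁ b₂ b, J b₁ b₂ b → b₁ ∈ s ∧ b₂ ∈ s) (hP : ∀ b₁ b, P b₁ b → b₁ ∈ s)
    (hF : ∀ b₁ b, F b₁ b → b₁ ∈ s) {b : β} (hb : b ∈ s) :
    ∃ M : List (List (Finset β × Bool)), ∀ (d : ℤ → β → Prop) (n : ℤ),
      HornClosure J P F d b n ↔ ∃ l ∈ M, Matches l d n := by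
  classical
  let letters : Set (Finset β × Bool) := (s.powerset : Set (Finset β)) ×ˢ Set.univ
  have hletters : letters.Finite := s.powerset.finite_toSet.prod Set.finite_univ
  let S : Set (List (Finset β × Bool)) :=
    {l | (∀ x ∈ l, x ∈ letters) ∧ ∀ d n, Matches l d n → HornClosure J P F d b n}
  obtain ⟨M, hMS, hM⟩ := exists_finite_sublist_basis (S := S) hletters fun l hl => hl.1
  refine ⟨M, fun d n => ⟨fun h => ?_, fun ⟨l, hl, h⟩ => (hMS l hl).2 d n h⟩⟩
  obtain ⟨K, hn, hK⟩ := h.exists_support hJ hP hF hb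
  let e := K.orderIsoOfFin rfl
  let l : List (Finset β × Bool) :=
    List.ofFn fun i => (s.filter (d (e i)), decide ((e i : ℤ) = n))
  have hlen : l.length = K.card := List.length_ofFn
  have hget : ∀ i : Fin l.length,
      l.get i = (s.filter (d (e (i.cast hlen))), decide ((e (i.cast hlen) : ℤ) = n)) := by
    intro i
    simp [l, Fin.cast]
  have hlS : l ∈ S := by
    refine ⟨fun x hx => ?_, fun d' n' ⟨f, hf, h'⟩ => ?_⟩
    · obtain ⟨i, rfl⟩ := List.mem_ofFn.1 hx
      exact ⟨Finset.mem_powerset.2 (Finset.filter_subset _ _), trivial⟩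
    · let φ : ℤ → ℤ := fun t => if ht : t ∈ K then f ((e.symm ⟨t, ht⟩).cast hlen.symm) else 0
      have hφ : ∀ t (ht : t ∈ K), φ t = f ((e.symm ⟨t, ht⟩).cast hlen.symm) := fun t ht =>
        dif_pos ht
      have key := hK d' φ ?_ ?_
      · have hmark := (h' ((e.symm ⟨n, hn⟩).cast hlen.symm)).2
        rw [← hφ, hget] at hmark
        rwa [hmark (by simp)] at key
      · intro t ht t' ht' htt'
        rw [hφ t ht, hφ t' ht']
        refine hf _ _ ?_
        have : e.symm ⟨t, ht⟩ < e.symm ⟨t', ht'⟩ := e.symm.strictMono htt'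
        exact this
      · intro t ht c hc hdc
        have hlab := (h' ((e.symm ⟨t, ht⟩).cast hlen.symm)).1 c
        rw [← hφ, hget] at hlab
        exact hlab (by simp [hc, hdc])
  obtain ⟨l', hl', hsub⟩ := hM l hlS
  refine ⟨l', hl', Matches.of_sublist ⟨fun i => e (i.cast hlen), ?_, ?_⟩ hsub⟩
  · intro i j hij
    have : e (i.cast hlen) < e (j.cast hlen) := e.strictMono hij
    exact this
  · intro i
    rw [hget]
    exact ⟨fun c hc => (Finset.mem_filter.1 hc).2, fun h => of_decide_eq_true h⟩

theorem Rewritable.hornClosure {β V : Type} {J : β → β → β → Prop} {P F : β → β → Prop}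
    {s : Finset β} (hJ : ∀ b₁ b₂ b, J b₁ b₂ b → b₁ ∈ s ∧ b₂ ∈ s) (hP : ∀ b₁ b, P b₁ b → b₁ ∈ s)
    (hF : ∀ b₁ b, F b₁ b → b₁ ∈ s) {d : ABox → (V → ℕ) → ℤ → β → Prop}
    (hd : ∀ (c : β) (W : Type) (τ : ℤ ⊕ W),
      Rewritable fun A av (nv : W → ℤ) => d A av (evalTT nv τ) c)
    (b : β) {W : Type} (τ : ℤ ⊕ W) :
    Rewritable fun A av (nv : W → ℤ) => HornClosure J P F (d A av) b (evalTT nv τ) := by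
  classical
  obtain ⟨M, hM⟩ := HornClosure.exists_matches_iff (s := insert b s) (b := b)
    (fun b₁ b₂ b h => ⟨Finset.mem_insert_of_mem (hJ b₁ b₂ b h).1,
      Finset.mem_insert_of_mem (hJ b₁ b₂ b h).2⟩)
    (fun b₁ b h => Finset.mem_insert_of_mem (hP b₁ b h))
    (fun b₁ b h => Finset.mem_insert_of_mem (hF b₁ b h)) (Finset.mem_insert_self b s)
  refine Rewritable.congr (Rewritable.existsMem M (Φ := fun l A av nv =>
    Matches l (d A av) (evalTT nv τ)) fun l _ => ?_) fun A av nv => hM _ _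
  let v : Fin l.length → ℤ ⊕ (W ⊕ Fin l.length) := fun i => Sum.inr (Sum.inr i)
  refine Rewritable.existsTime (Φ := fun A av nv =>
    (∀ i j, i < j → evalTT nv (v i) < evalTT nv (v j)) ∧
      ∀ i, (∀ b ∈ (l.get i).1, d A av (evalTT nv (v i)) b) ∧
        ((l.get i).2 = Bool.true → evalTT nv (v i) = evalTT nv (Sum.map id Sum.inl τ)))
    (.and ?_ ?_) |>.congr fun A av nv => ?_
  · exact .forallFinite fun i => .forallFinite fun j => .imp (.atom (.lt (v i) (v j)))
  · refine .forallFinite fun i => .and ?_ (.imp (.atom (.eq (v i) (Sum.map id Sum.inl τ))))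
    exact (Rewritable.forallMem (l.get i).1.toList fun c _ => hd c _ (v i)).congr (by simp)
  · simp only [evalTT_map, Sum.elim_comp_inl]
    rfl

/-! ## The canonical model of a flat knowledge base -/

theorem BRole.minus_minus (R : BRole) : R.minus.minus = R := by
  cases R <;> rfl

theorem BRole.mem_interp_minus (I : Interp D) (R : BRole) (n : ℤ) (x y : D) :
    (x, y) ∈ R.minus.interp I n ↔ (y, x) ∈ R.interp I n := by
  cases R <;> rfl

/-- The conjunctive role rules of `T`, closed under taking inverses. -/
def roleJoin (T : TBox) (R₁ R₂ R : BRole) : Prop :=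
  .ri (.inter (.basic R₁) (.basic R₂)) R ∈ T ∨
    .ri (.inter (.basic R₁.minus) (.basic R₂.minus)) R.minus ∈ T

/-- The past role rules of `T`, closed under taking inverses. -/
def rolePast (T : TBox) (R₁ R : BRole) : Prop :=
  .ri (.diaP (.basic R₁)) R ∈ T ∨ .ri (.diaP (.basic R₁.minus)) R.minus ∈ T

/-- The future role rules of `T`, closed under taking inverses. -/
def roleFuture (T : TBox) (R₁ R : BRole) : Prop :=
  .ri (.diaF (.basic R₁)) R ∈ T ∨ .ri (.diaF (.basic R₁.minus)) R.minus ∈ T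

/-- The basic roles asserted by the ABox between two individuals. -/
def roleData (A : ABox) (x y : ℕ) (n : ℤ) : BRole → Prop
  | .bot => False
  | .name p => .role p x y n ∈ A
  | .inv p => .role p y x n ∈ A

/-- The role atoms of the canonical model. -/
def RoleCl (T : TBox) (A : ABox) (R : BRole) (x y : ℕ) (n : ℤ) : Prop :=
  HornClosure (roleJoin T) (rolePast T) (roleFuture T) (roleData A x y) R n

/-- The basic concepts of an individual given by the ABox and the role atoms. -/
def concData (T : TBox) (A : ABox) (x : ℕ) (n : ℤ) : BConcept → Prop
  | .bot => False
  | .name a => .conc a x n ∈ A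
  | .ex R => ∃ y, RoleCl T A R x y n

/-- The concept atoms of the canonical model. -/
def ConcCl (T : TBox) (A : ABox) (B : BConcept) (x : ℕ) (n : ℤ) : Prop :=
  HornClosure (fun B₁ B₂ B => .ci (.inter (.basic B₁) (.basic B₂)) B ∈ T)
    (fun B₁ B => .ci (.diaP (.basic B₁)) B ∈ T) (fun B₁ B => .ci (.diaF (.basic B₁)) B ∈ T)
    (concData T A x) B n

theorem mem_aboxInds_of_conc {A : ABox} {a x : ℕ} {n : ℤ} (h : .conc a x n ∈ A) :
    x ∈ aboxInds A :=
  Finset.mem_biUnion.2 ⟨_, h, by simp [ABoxAtom.inds]⟩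

theorem mem_aboxInds_of_role {A : ABox} {p x y : ℕ} {n : ℤ} (h : .role p x y n ∈ A) :
    x ∈ aboxInds A ∧ y ∈ aboxInds A :=
  ⟨Finset.mem_biUnion.2 ⟨_, h, by simp [ABoxAtom.inds]⟩,
    Finset.mem_biUnion.2 ⟨_, h, by simp [ABoxAtom.inds]⟩⟩

theorem RoleCl.mem_aboxInds {T : TBox} {A : ABox} {R : BRole} {x y : ℕ} {n : ℤ}
    (h : RoleCl T A R x y n) : x ∈ aboxInds A ∧ y ∈ aboxInds A := by
  obtain ⟨m, c, h⟩ := h.exists_base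
  cases c with
  | bot => exact h.elim
  | name p => exact mem_aboxInds_of_role h
  | inv p => exact (mem_aboxInds_of_role h).symm

theorem ConcCl.mem_aboxInds {T : TBox} {A : ABox} {B : BConcept} {x : ℕ} {n : ℤ}
    (h : ConcCl T A B x n) : x ∈ aboxInds A := by
  obtain ⟨m, c, h⟩ := h.exists_base
  cases c with
  | bot => exact h.elim
  | name a => exact mem_aboxInds_of_conc h
  | ex R => exact h.choose_spec.mem_aboxInds.1

theorem RoleCl.minus {T : TBox} {A : ABox} {R : BRole} {x y : ℕ} {n : ℤ}
    (h : RoleCl T A R x y n) : RoleCl T A R.minus y x n := by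
  induction h with
  | @base R n h => exact .base (by cases R <;> exact h)
  | join hj _ _ ih₁ ih₂ =>
    exact .join (by simpa only [roleJoin, BRole.minus_minus] using hj.symm) ih₁ ih₂
  | past hp _ hmn ih =>
    exact .past (by simpa only [rolePast, BRole.minus_minus] using hp.symm) ih hmn
  | future hp _ hmn ih =>
    exact .future (by simpa only [roleFuture, BRole.minus_minus] using hp.symm) ih hmn

theorem RoleCl.sound {T : TBox} {A : ABox} {I : Interp D} (hI : IsModel I T A) {R : BRole}
    {x y : ℕ} {n : ℤ} (h : RoleCl T A R x y n) :
    (I.constI x, I.constI y) ∈ R.interp I n := by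
  induction h with
  | @base R n h =>
    cases R with
    | bot => exact h.elim
    | name p => exact hI.2 _ h
    | inv p => exact hI.2 _ h
  | join hj _ _ ih₁ ih₂ =>
    rcases hj with hj | hj
    · exact hI.1 _ hj _ ⟨ih₁, ih₂⟩
    · rw [← BRole.mem_interp_minus] at ih₁ ih₂ ⊢
      exact hI.1 _ hj _ ⟨ih₁, ih₂⟩
  | past hp _ hmn ih =>
    rcases hp with hp | hp
    · exact hI.1 _ hp _ ⟨_, hmn, ih⟩
    · rw [← BRole.mem_interp_minus] at ih ⊢
      exact hI.1 _ hp _ ⟨_, hmn, ih⟩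
  | future hp _ hmn ih =>
    rcases hp with hp | hp
    · exact hI.1 _ hp _ ⟨_, hmn, ih⟩
    · rw [← BRole.mem_interp_minus] at ih ⊢
      exact hI.1 _ hp _ ⟨_, hmn, ih⟩

theorem ConcCl.sound {T : TBox} {A : ABox} {I : Interp D} (hI : IsModel I T A) {B : BConcept}
    {x : ℕ} {n : ℤ} (h : ConcCl T A B x n) : I.constI x ∈ B.interp I n := by
  induction h with
  | @base B n h =>
    cases B with
    | bot => exact h.elim
    | name a => exact hI.2 _ h
    | ex R => exact ⟨_, h.choose_spec.sound hI⟩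
  | join hj _ _ ih₁ ih₂ => exact hI.1 _ hj _ ⟨ih₁, ih₂⟩
  | past hp _ hmn ih => exact hI.1 _ hp _ ⟨_, hmn, ih⟩
  | future hp _ hmn ih => exact hI.1 _ hp _ ⟨_, hmn, ih⟩

/-- The canonical model of a flat knowledge base as an interpretation with domain `ℕ`. -/
def canonicalInterp (T : TBox) (A : ABox) : Interp ℕ where
  constI := id
  constInj := Function.injective_id
  concI a n := {x | ConcCl T A (.name a) x n}
  roleI p n := {xy | RoleCl T A (.name p) xy.1 xy.2 n}

theorem mem_canonicalInterp_role {T : TBox} {A : ABox} (hA : Consistent T A) (R : BRole)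
    (xy : ℕ × ℕ) (n : ℤ) :
    xy ∈ R.interp (canonicalInterp T A) n ↔ RoleCl T A R xy.1 xy.2 n := by
  cases R with
  | bot =>
    obtain ⟨D, _, I, hI⟩ := hA
    exact ⟨False.elim, fun h => h.sound hI⟩
  | name p => rfl
  | inv p => exact ⟨RoleCl.minus, RoleCl.minus⟩

theorem mem_canonicalInterp_conc {T : TBox} {A : ABox} (hflat : IsFlat T)
    (hA : Consistent T A) (B : BConcept) (x : ℕ) (n : ℤ) :
    x ∈ B.interp (canonicalInterp T A) n ↔ ConcCl T A B x n := by
  cases B with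
  | bot =>
    obtain ⟨D, _, I, hI⟩ := hA
    exact ⟨False.elim, fun h => h.sound hI⟩
  | name a => rfl
  | ex R =>
    constructor
    · rintro ⟨y, h⟩
      exact .base ⟨y, (mem_canonicalInterp_role hA R (x, y) n).1 h⟩
    · rintro (⟨y, h⟩ | h | h | h)
      · exact ⟨y, (mem_canonicalInterp_role hA R (x, y) n).2 h⟩
      all_goals exact absurd h (hflat.2 _ _)

theorem canonicalInterp_isModel {T : TBox} {A : ABox} (hflat : IsFlat T)
    (hA : Consistent T A) : IsModel (canonicalInterp T A) T A := by
  refine ⟨fun incl hincl => ?_, fun α hα => ?_⟩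
  · have hnf := hflat.1 incl hincl
    cases incl with
    | ci c B =>
      intro n x hx
      rw [mem_canonicalInterp_conc hflat hA]
      rcases hnf with ⟨B₁, B₂, rfl⟩ | ⟨B₁, rfl⟩ | ⟨B₁, rfl⟩
      · exact .join hincl ((mem_canonicalInterp_conc hflat hA _ _ _).1 hx.1)
          ((mem_canonicalInterp_conc hflat hA _ _ _).1 hx.2)
      · obtain ⟨m, hm, hx⟩ := hx
        exact .future hincl ((mem_canonicalInterp_conc hflat hA _ _ _).1 hx) hm
      · obtain ⟨m, hm, hx⟩ := hx
        exact .past hincl ((mem_canonicalInterp_conc hflat hA _ _ _).1 hx) hm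
    | ri S R =>
      intro n x hx
      rw [mem_canonicalInterp_role hA]
      rcases hnf with ⟨R₁, R₂, rfl⟩ | ⟨R₁, rfl⟩ | ⟨R₁, rfl⟩
      · exact .join (.inl hincl) ((mem_canonicalInterp_role hA _ _ _).1 hx.1)
          ((mem_canonicalInterp_role hA _ _ _).1 hx.2)
      · obtain ⟨m, hm, hx⟩ := hx
        exact .future (.inl hincl) ((mem_canonicalInterp_role hA _ _ _).1 hx) hm
      · obtain ⟨m, hm, hx⟩ := hx
        exact .past (.inl hincl) ((mem_canonicalInterp_role hA _ _ _).1 hx) hm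
  · cases α with
    | conc a x n => exact .base hα
    | role p x y n => exact .base hα

/-! ## Certain answers and the canonical model -/

/-- Satisfaction of a query atom in the canonical model. -/
def QAtom.holdsCan {V W : Type} (T : TBox) (A : ABox) (gI : V → ℕ) (gT : W → ℤ) :
    QAtom V W → Prop
  | .conc a ξ τ => ConcCl T A (.name a) (evalIT id gI ξ) (evalTT gT τ)
  | .role p ξ ζ τ => RoleCl T A (.name p) (evalIT id gI ξ) (evalIT id gI ζ) (evalTT gT τ)
  | .eq τ σ => evalTT gT τ = evalTT gT σ
  | .lt τ σ => evalTT gT τ < evalTT gT σ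

theorem evalIT_comp {V : Type} (c : ℕ → D) (g : V → ℕ) (ξ : ℕ ⊕ V) :
    evalIT c (c ∘ g) ξ = c (evalIT id g ξ) := by
  cases ξ <;> rfl

theorem certainAnswer_iff {T : TBox} {A : ABox} (hflat : IsFlat T) (hA : Consistent T A)
    {nx ns : ℕ} (q : CQ nx ns) (av : Fin nx → ℕ) (nv : Fin ns → ℤ) :
    CertainAnswer T A q av nv ↔ ∃ (bv : Fin q.ny → ℕ) (bt : Fin q.nt → ℤ),
      ∀ α ∈ q.atoms, α.holdsCan T A (Sum.elim av bv) (Sum.elim nv bt) := by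
  constructor
  · intro h
    obtain ⟨bv, bt, h⟩ := h ℕ inferInstance _ (canonicalInterp_isModel hflat hA)
    refine ⟨bv, bt, fun α hα => ?_⟩
    have := h α hα
    cases α <;> exact this
  · rintro ⟨bv, bt, h⟩ D _ I hI
    refine ⟨I.constI ∘ bv, bt, fun α hα => ?_⟩
    have hα := h α hα
    have e : Sum.elim (fun i => I.constI (av i)) (I.constI ∘ bv) =
        I.constI ∘ Sum.elim av bv := (Sum.comp_elim _ _ _).symm
    rw [e]
    cases α with
    | conc a ξ τ =>
      simp only [QAtom.holdsI, evalIT_comp]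
      exact ConcCl.sound hI hα
    | role p ξ ζ τ =>
      simp only [QAtom.holdsI, evalIT_comp]
      exact RoleCl.sound hI hα
    | eq τ σ => exact hα
    | lt τ σ => exact hα

/-- Assignments that agree on all values among the ABox individuals satisfy the same atoms. -/
theorem QAtom.holdsCan_congr {V W : Type} {T : TBox} {A : ABox} {gI gI' : V → ℕ} {gT : W → ℤ}
    (hg : ∀ v, gI v ∈ aboxInds A → gI' v = gI v) {α : QAtom V W}
    (h : α.holdsCan T A gI gT) : α.holdsCan T A gI' gT := by
  have key : ∀ ξ, evalIT id gI ξ ∈ aboxInds A → evalIT id gI' ξ = evalIT id gI ξ := by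
    rintro (c | v) hξ
    exacts [rfl, hg v hξ]
  cases α with
  | conc a ξ τ =>
    simp only [QAtom.holdsCan] at h ⊢
    rwa [key ξ h.mem_aboxInds]
  | role p ξ ζ τ =>
    simp only [QAtom.holdsCan] at h ⊢
    rwa [key ξ h.mem_aboxInds.1, key ζ h.mem_aboxInds.2]
  | eq τ σ => exact h
  | lt τ σ => exact h

/-- Quantification over the whole domain of the canonical model reduces to quantification over
the ABox individuals, except possibly for the constant assignment. -/
theorem exists_holdsCan_iff {V Y W : Type} {T : TBox} {A : ABox}
    (atoms : List (QAtom (V ⊕ Y) W)) (av : V → ℕ) (gT : W → ℤ) :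
    (∃ bv : Y → ℕ, ∀ α ∈ atoms, α.holdsCan T A (Sum.elim av bv) gT) ↔
      (∃ bv : Y → ℕ, (∀ i, bv i ∈ aboxInds A) ∧
        ∀ α ∈ atoms, α.holdsCan T A (Sum.elim av bv) gT) ∨
      ∀ α ∈ atoms, α.holdsCan T A (Sum.elim av fun _ => 0) gT := by
  constructor
  · rintro ⟨bv, h⟩
    rcases (aboxInds A).eq_empty_or_nonempty with hA | ⟨d, hd⟩
    · refine .inr fun α hα => QAtom.holdsCan_congr (fun v hv => ?_) (h α hα)
      rcases v with v | v
      exacts [rfl, absurd hv (by simp [hA])]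
    · refine .inl ⟨fun i => if bv i ∈ aboxInds A then bv i else d, fun i => ?_, fun α hα =>
        QAtom.holdsCan_congr (fun v hv => ?_) (h α hα)⟩
      · dsimp only
        split_ifs with hi
        exacts [hi, hd]
      · rcases v with v | v
        exacts [rfl, if_pos hv]
  · rintro (⟨bv, -, h⟩ | h)
    exacts [⟨bv, h⟩, ⟨_, h⟩]

/-! ## Rewritability of the canonical model -/

/-- The basic concepts on the left-hand side of an inclusion in normal form. -/
def Inclusion.lhsConcepts : Inclusion → Finset BConcept
  | .ci (.inter (.basic B₁) (.basic B₂)) _ => {B₁, B₂}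
  | .ci (.diaP (.basic B)) _ => {B}
  | .ci (.diaF (.basic B)) _ => {B}
  | _ => ∅

/-- The basic roles, and their inverses, on the left-hand side of an inclusion in normal form. -/
def Inclusion.lhsRoles : Inclusion → Finset BRole
  | .ri (.inter (.basic R₁) (.basic R₂)) _ => {R₁, R₂, R₁.minus, R₂.minus}
  | .ri (.diaP (.basic R)) _ => {R, R.minus}
  | .ri (.diaF (.basic R)) _ => {R, R.minus}
  | _ => ∅

theorem rewritable_roleCl (T : TBox) (R : BRole) {V W : Type} (ξ ζ : ℕ ⊕ V) (τ : ℤ ⊕ W) :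
    Rewritable fun A (av : V → ℕ) nv =>
      RoleCl T A R (evalIT id av ξ) (evalIT id av ζ) (evalTT nv τ) := by
  refine Rewritable.hornClosure (s := T.biUnion Inclusion.lhsRoles)
    (d := fun A av n c => roleData A (evalIT id av ξ) (evalIT id av ζ) n c) ?_ ?_ ?_ ?_ R τ
  · rintro R₁ R₂ R (h | h) <;>
      exact ⟨Finset.mem_biUnion.2 ⟨_, h, by simp [Inclusion.lhsRoles, BRole.minus_minus]⟩,
        Finset.mem_biUnion.2 ⟨_, h, by simp [Inclusion.lhsRoles, BRole.minus_minus]⟩⟩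
  · rintro R₁ R (h | h) <;>
      exact Finset.mem_biUnion.2 ⟨_, h, by simp [Inclusion.lhsRoles, BRole.minus_minus]⟩
  · rintro R₁ R (h | h) <;>
      exact Finset.mem_biUnion.2 ⟨_, h, by simp [Inclusion.lhsRoles, BRole.minus_minus]⟩
  · intro c W τ
    cases c with
    | bot => exact .false
    | name p => exact .atom (.role p ξ ζ τ)
    | inv p => exact .atom (.role p ζ ξ τ)

theorem rewritable_concCl (T : TBox) (B : BConcept) {V W : Type} (ξ : ℕ ⊕ V) (τ : ℤ ⊕ W) :
    Rewritable fun A (av : V → ℕ) nv => ConcCl T A B (evalIT id av ξ) (evalTT nv τ) := by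
  refine Rewritable.hornClosure (s := T.biUnion Inclusion.lhsConcepts)
    (d := fun A av n c => concData T A (evalIT id av ξ) n c) ?_ ?_ ?_ ?_ B τ
  · exact fun B₁ B₂ B h => ⟨Finset.mem_biUnion.2 ⟨_, h, by simp [Inclusion.lhsConcepts]⟩,
      Finset.mem_biUnion.2 ⟨_, h, by simp [Inclusion.lhsConcepts]⟩⟩
  · exact fun B₁ B h => Finset.mem_biUnion.2 ⟨_, h, by simp [Inclusion.lhsConcepts]⟩
  · exact fun B₁ B h => Finset.mem_biUnion.2 ⟨_, h, by simp [Inclusion.lhsConcepts]⟩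
  · intro c W τ
    cases c with
    | bot => exact .false
    | name a => exact .atom (.conc a ξ τ)
    | ex R =>
      refine (rewritable_roleCl T R (Sum.map id Sum.inl ξ) (.inr (.inr ())) τ).existsInd
        (Y := Unit) |>.congr fun A av nv => ?_
      simp only [evalIT_map, Sum.elim_comp_inl]
      constructor
      · rintro ⟨y, h⟩
        exact ⟨fun _ => y, fun _ => h.mem_aboxInds.2, h⟩
      · rintro ⟨b, -, h⟩
        exact ⟨_, h⟩

theorem rewritable_holdsCan (T : TBox) {V W : Type} (α : QAtom V W) :
    Rewritable fun A (av : V → ℕ) nv => α.holdsCan T A av nv := by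
  cases α with
  | conc a ξ τ => exact rewritable_concCl T (.name a) ξ τ
  | role p ξ ζ τ => exact rewritable_roleCl T (.name p) ξ ζ τ
  | eq τ σ => exact .atom (.eq τ σ)
  | lt τ σ => exact .atom (.lt τ σ)

/-- Replacing some individual variables by a constant preserves rewritability of query atoms. -/
theorem rewritable_holdsCan_zero (T : TBox) {V Y W : Type} (α : QAtom (V ⊕ Y) W) :
    Rewritable fun A (av : V → ℕ) nv => α.holdsCan T A (Sum.elim av fun _ => 0) nv := by
  let sub : ℕ ⊕ (V ⊕ Y) → ℕ ⊕ V := Sum.elim Sum.inl (Sum.elim Sum.inr fun _ => Sum.inl 0)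
  have hsub : ∀ (av : V → ℕ) ξ,
      evalIT id (Sum.elim av fun _ => 0) ξ = evalIT id av (sub ξ) := by
    rintro av (c | v | y) <;> rfl
  cases α with
  | conc a ξ τ =>
    simp only [QAtom.holdsCan, hsub]
    exact rewritable_concCl T (.name a) _ τ
  | role p ξ ζ τ =>
    simp only [QAtom.holdsCan, hsub]
    exact rewritable_roleCl T (.name p) _ _ τ
  | eq τ σ => exact .atom (.eq τ σ)
  | lt τ σ => exact .atom (.lt τ σ)

/-- Theorem 4, first part: rewriting for flat TBoxes over `A^ℤ`. -/
theorem flat_rewriting (T : TBox) (hflat : IsFlat T) (nx ns : ℕ) (q : CQ nx ns) :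
    ∃ q' : UCQ nx ns, ∀ A : ABox, Consistent T A →
      ∀ (av : Fin nx → ℕ) (nv : Fin ns → ℤ), (∀ i, av i ∈ aboxInds A) →
        (CertainAnswer T A q av nv ↔ UCQ.holdsOn q' (intData A) av nv) := by
  have h : Rewritable fun A (av : Fin nx → ℕ) (nv : Fin ns → ℤ) =>
      ∃ (bv : Fin q.ny → ℕ) (bt : Fin q.nt → ℤ),
        ∀ α ∈ q.atoms, α.holdsCan T A (Sum.elim av bv) (Sum.elim nv bt) := by
    refine Rewritable.congr (Rewritable.existsTime (Φ := fun A av nv =>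
      (∃ bv : Fin q.ny → ℕ, (∀ i, bv i ∈ aboxInds A) ∧
        ∀ α ∈ q.atoms, α.holdsCan T A (Sum.elim av bv) nv) ∨
      ∀ α ∈ q.atoms, α.holdsCan T A (Sum.elim av fun _ => 0) nv)
      (.or (Rewritable.existsInd (.forallMem _ fun α _ => rewritable_holdsCan T α))
        (.forallMem _ fun α _ => rewritable_holdsCan_zero T α))) fun A av nv => ?_
    rw [exists_comm]
    exact exists_congr fun bt => exists_holdsCan_iff _ _ _
  obtain ⟨Q, hQ⟩ := h.exists_ucq
  exact ⟨Q, fun A hA av nv _ => (certainAnswer_iff hflat hA q av nv).trans (hQ A av nv)⟩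

end TQL
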